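/- Let T be an accretive operator on a complex Hilbert space H such that T² is m-accretive. If R(T) is closed, then R(T²) is closed and γ(T²) ≥ γ(T)²/2, where γ denotes the reduced minimum modulus. -/

import Mathlib

open scoped ComplexInnerProductSpace
noncomputable section

variable {H : Type*} [NormedAddCommGroup H] [InnerProductSpace ℂ H] [CompleteSpace H]

/-- The range of a partially defined operator, as a submodule of `H`. -/
def pRange (T : H →ₗ.[ℂ] H) : Submodule ℂ H := LinearMap.range T.toFun

/-- The kernel of a partially defined operator, as a submodule of `H`. -/
def pKer (T : H →ₗ.[ℂ] H) : Submodule ℂ H := (LinearMap.ker T.toFun).map T.domain.subtype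

/-- An operator `T` is accretive if `Re ⟨T x, x⟩ ≥ 0` for all `x` in its domain. -/
def PAccretive (T : H →ₗ.[ℂ] H) : Prop := ∀ x : T.domain, 0 ≤ (⟪(x : H), T x⟫).re

/-- `T` is m-accretive: accretive, densely defined, closed, and `R(μ + T) = H` for all `μ > 0`. -/
def MAccretive (T : H →ₗ.[ℂ] H) : Prop :=
  PAccretive T ∧ Dense (T.domain : Set H) ∧ IsClosed (T.graph : Set (H × H)) ∧
    ∀ μ : ℝ, 0 < μ → ∀ y : H, ∃ x : T.domain, (μ : ℂ) • (x : H) + T x = y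

/-- `T` is sectorial with vertex `0` and semiangle `ω` (ω-accretive):
`W(T) ⊆ {z : |arg z| ≤ ω}`. -/
def SectorialP (T : H →ₗ.[ℂ] H) (ω : ℝ) : Prop :=
  ∀ x : T.domain, ‖(x : H)‖ = 1 → |(⟪(x : H), T x⟫).arg| ≤ ω

/-- `y` is the orthogonal projection of `x` onto the closure of `M`. -/
def IsProjOnto (M : Submodule ℂ H) (x y : H) : Prop :=
  y ∈ M.topologicalClosure ∧ x - y ∈ Mᗮ

/-- `Td` is the Moore-Penrose inverse of `T`: a closed densely defined operator with
domain `R(T) ⊕ R(T)ᗮ` such that `T Td T = T` on `D(T)`, `Td T Td = Td` on `D(Td)`,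
`T Td = P_{cl R(T)}` on `D(Td)` and `Td T = P_{N(T)ᗮ}` on `D(T)`. -/
structure IsMoorePenroseInverse (T Td : H →ₗ.[ℂ] H) : Prop where
  closed' : IsClosed (Td.graph : Set (H × H))
  dense' : Dense (Td.domain : Set H)
  domain_eq : Td.domain = pRange T ⊔ (pRange T)ᗮ
  tdt : ∀ x : T.domain, ∃ (h1 : T x ∈ Td.domain) (h2 : Td ⟨T x, h1⟩ ∈ T.domain),
    T ⟨Td ⟨T x, h1⟩, h2⟩ = T x
  dtd : ∀ x : Td.domain, ∃ (h1 : Td x ∈ T.domain) (h2 : T ⟨Td x, h1⟩ ∈ Td.domain),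
    Td ⟨T ⟨Td x, h1⟩, h2⟩ = Td x
  proj_range : ∀ x : Td.domain, ∃ h1 : Td x ∈ T.domain,
    IsProjOnto (pRange T) (x : H) (T ⟨Td x, h1⟩)
  proj_ker : ∀ x : T.domain, ∃ h1 : T x ∈ Td.domain,
    IsProjOnto ((pKer T)ᗮ) (x : H) (Td ⟨T x, h1⟩)

/-- A bounded everywhere-defined operator viewed as a partially defined operator. -/
def clmToPMap (S : H →L[ℂ] H) : H →ₗ.[ℂ] H := S.toLinearMap.toPMap ⊤

/-- A partially defined operator is bounded if it is bounded on its domain. -/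
def BoundedPMap (T : H →ₗ.[ℂ] H) : Prop := ∃ C : ℝ, ∀ x : T.domain, ‖T x‖ ≤ C * ‖(x : H)‖

/-- `T Td = Td T` on `D(T)`. -/
def CommutesOnDomain (T Td : H →ₗ.[ℂ] H) : Prop :=
  ∀ x : T.domain, ∃ (h1 : (x : H) ∈ Td.domain) (h2 : Td ⟨(x : H), h1⟩ ∈ T.domain)
    (h3 : T x ∈ Td.domain), T ⟨Td ⟨(x : H), h1⟩, h2⟩ = Td ⟨T x, h3⟩

/-- `T` is an EP operator: its Moore-Penrose inverse is bounded and `T T† = T† T` on `D(T)`. -/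
def IsEPPMap (T : H →ₗ.[ℂ] H) : Prop :=
  ∃ Td : H →ₗ.[ℂ] H, IsMoorePenroseInverse T Td ∧ BoundedPMap Td ∧ CommutesOnDomain T Td

/-- The sum `T + S` of a partially defined operator and a bounded operator, with domain `D(T)`. -/
def addB (T : H →ₗ.[ℂ] H) (S : H →L[ℂ] H) : H →ₗ.[ℂ] H :=
  ⟨T.domain, T.toFun + S.toLinearMap.comp T.domain.subtype⟩

/-- The sum of two partially defined operators, with domain `D(A) ∩ D(B)`. -/
def pAdd (A B : H →ₗ.[ℂ] H) : H →ₗ.[ℂ] H :=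
  ⟨A.domain ⊓ B.domain,
    A.toFun.comp (Submodule.inclusion inf_le_left) +
      B.toFun.comp (Submodule.inclusion inf_le_right)⟩

/-- The difference of two partially defined operators, with domain `D(A) ∩ D(B)`. -/
def pSub (A B : H →ₗ.[ℂ] H) : H →ₗ.[ℂ] H :=
  ⟨A.domain ⊓ B.domain,
    A.toFun.comp (Submodule.inclusion inf_le_left) -
      B.toFun.comp (Submodule.inclusion inf_le_right)⟩

/-- The operator `-A - r` on `D(A)`. -/
def negShift (A : H →ₗ.[ℂ] H) (r : ℝ) : H →ₗ.[ℂ] H :=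
  ⟨A.domain, -A.toFun - (r : ℂ) • A.domain.subtype⟩

/-- The composition `B ∘ A` of a bounded operator with a partially defined one. -/
def compB (B : H →L[ℂ] H) (A : H →ₗ.[ℂ] H) : H →ₗ.[ℂ] H :=
  ⟨A.domain, B.toLinearMap.comp A.toFun⟩

/-- `T2` is the square `T ∘ T` of `T`, with domain `{x ∈ D(T) : T x ∈ D(T)}`. -/
def IsSquareOf (T T2 : H →ₗ.[ℂ] H) : Prop :=
  (∀ x : T2.domain, ∃ (h1 : (x : H) ∈ T.domain) (h2 : T ⟨(x : H), h1⟩ ∈ T.domain),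
      T2 x = T ⟨T ⟨(x : H), h1⟩, h2⟩) ∧
  ∀ x : H, x ∈ T2.domain ↔ ∃ h : x ∈ T.domain, T ⟨x, h⟩ ∈ T.domain

/-- The reduced minimum modulus `γ(T) = inf {‖T x‖ : x ∈ N(T)ᗮ ∩ D(T), ‖x‖ = 1}`. -/
def gammaP (T : H →ₗ.[ℂ] H) : ℝ :=
  sInf {r | ∃ x : T.domain, (x : H) ∈ (pKer T)ᗮ ∧ ‖(x : H)‖ = 1 ∧ r = ‖T x‖}

/-- The spectrum of a partially defined operator: the complement of the set of `μ` for which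
`μ - A` has an everywhere-defined bounded inverse. -/
def pSpectrum (A : H →ₗ.[ℂ] H) : Set ℂ :=
  {μ | ¬ ∃ B : H →L[ℂ] H, (∀ x : A.domain, B (μ • (x : H) - A x) = (x : H)) ∧
        ∀ y : H, ∃ h : B y ∈ A.domain, μ • B y - A ⟨B y, h⟩ = y}

/-- The numerical radius of a partially defined operator. -/
def pNumRad (A : H →ₗ.[ℂ] H) : ℝ :=
  sSup {r | ∃ x : A.domain, ‖(x : H)‖ = 1 ∧ r = ‖⟪(x : H), A x⟫‖}

/-- `B` is an everywhere-defined bounded inverse of the partially defined operator `A`. -/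
def IsBoundedInverseOf (A : H →ₗ.[ℂ] H) (B : H →L[ℂ] H) : Prop :=
  (∀ x : A.domain, B (A x) = (x : H)) ∧ ∀ y : H, ∃ h : B y ∈ A.domain, A ⟨B y, h⟩ = y

/-- The real part `(T + T*)/2` of a bounded operator. -/
def reOp (T : H →L[ℂ] H) : H →L[ℂ] H := (2 : ℂ)⁻¹ • (T + ContinuousLinearMap.adjoint T)

/-- The imaginary part `(T - T*)/(2i)` of a bounded operator. -/
def imOp (T : H →L[ℂ] H) : H →L[ℂ] H :=
  (2 * Complex.I)⁻¹ • (T - ContinuousLinearMap.adjoint T)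

/-- A bounded operator is accretive if `Re ⟨T x, x⟩ ≥ 0` for all `x`. -/
def CAccretive (T : H →L[ℂ] H) : Prop := ∀ x : H, 0 ≤ (⟪x, T x⟫).re

/-- A bounded operator is sectorial with vertex `0` and semiangle `ω` if
`W(T) ⊆ {z : |arg z| ≤ ω}`. -/
def Sectorial (T : H →L[ℂ] H) (ω : ℝ) : Prop :=
  ∀ x : H, ‖x‖ = 1 → |(⟪x, T x⟫).arg| ≤ ω

/-- The numerical radius `w(T) = sup {|⟨T x, x⟩| : ‖x‖ = 1}` of a bounded operator. -/
def numRad (T : H →L[ℂ] H) : ℝ := sSup {r | ∃ x : H, ‖x‖ = 1 ∧ r = ‖⟪x, T x⟫‖}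

omit [CompleteSpace H] in
lemma mem_pKer {T : H →ₗ.[ℂ] H} {x : H} : x ∈ pKer T ↔ ∃ h : x ∈ T.domain, T ⟨x, h⟩ = 0 := by
  constructor
  · rintro ⟨y, hy, rfl⟩
    exact ⟨y.2, hy⟩
  · rintro ⟨h, hx⟩
    exact ⟨⟨x, h⟩, hx, rfl⟩

omit [CompleteSpace H] in
lemma apply_mem_pRange (T : H →ₗ.[ℂ] H) (x : T.domain) : T x ∈ pRange T :=
  ⟨x, rfl⟩

omit [CompleteSpace H] in
lemma gammaP_nonneg (T : H →ₗ.[ℂ] H) : 0 ≤ gammaP T := by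
  refine Real.sInf_nonneg ?_
  rintro r ⟨x, -, -, rfl⟩
  exact norm_nonneg _

omit [CompleteSpace H] in
lemma gammaP_mul_norm_le (T : H →ₗ.[ℂ] H) (x : T.domain) (hx : (x : H) ∈ (pKer T)ᗮ) :
    gammaP T * ‖(x : H)‖ ≤ ‖T x‖ := by
  by_cases h0 : (x : H) = 0
  · simp [h0]
  have hpos : 0 < ‖(x : H)‖ := norm_pos_iff.mpr h0
  have hle : gammaP T ≤ ‖T (((‖(x : H)‖⁻¹ : ℝ) : ℂ) • x)‖ := by
    refine csInf_le ⟨0, ?_⟩ ⟨((‖(x : H)‖⁻¹ : ℝ) : ℂ) • x, ?_, ?_, rfl⟩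
    · rintro r ⟨y, -, -, rfl⟩
      exact norm_nonneg _
    · exact Submodule.smul_mem _ _ hx
    · rw [Submodule.coe_smul, norm_smul, Complex.norm_real, norm_inv, norm_norm,
        inv_mul_cancel₀ hpos.ne']
  rw [LinearPMap.map_smul, norm_smul, Complex.norm_real, norm_inv, norm_norm] at hle
  calc gammaP T * ‖(x : H)‖ ≤ (‖(x : H)‖⁻¹ * ‖T x‖) * ‖(x : H)‖ := by gcongr
    _ = ‖T x‖ := by field_simp

omit [CompleteSpace H] in
/-- The kernel of an accretive operator is orthogonal to its range. -/
lemma PAccretive.inner_eq_zero {T : H →ₗ.[ℂ] H} (hT : PAccretive T) {u : H} (hu : u ∈ pKer T)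
    (v : T.domain) : ⟪u, T v⟫ = 0 := by
  obtain ⟨hd, hu0⟩ := mem_pKer.mp hu
  set z : ℂ := ⟪u, T v⟫ with hz
  by_contra hne
  have hpos : 0 < Complex.normSq z := Complex.normSq_pos.mpr hne
  set s : ℝ := -((⟪(v : H), T v⟫).re + 1) / Complex.normSq z with hs
  have h := hT (v + ((s : ℂ) * z) • ⟨u, hd⟩)
  rw [LinearPMap.map_add, LinearPMap.map_smul, hu0, smul_zero, add_zero, Submodule.coe_add,
    Submodule.coe_smul, inner_add_left, inner_smul_left, ← hz, Complex.add_re, map_mul,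
    Complex.conj_ofReal, mul_assoc, ← Complex.normSq_eq_conj_mul_self, ← Complex.ofReal_mul,
    Complex.ofReal_re, hs, div_mul_cancel₀ _ hpos.ne'] at h
  linarith

omit [CompleteSpace H] in
lemma PAccretive.pRange_le {T : H →ₗ.[ℂ] H} (hT : PAccretive T) : pRange T ≤ (pKer T)ᗮ := by
  rintro _ ⟨v, rfl⟩
  exact (Submodule.mem_orthogonal _ _).mpr fun u hu => hT.inner_eq_zero hu v

omit [CompleteSpace H] in
/-- For an m-accretive operator, the orthogonal complement of the range lies in the kernel. -/
lemma MAccretive.orthogonal_pRange_le {T : H →ₗ.[ℂ] H} (hT : MAccretive T) :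
    (pRange T)ᗮ ≤ pKer T := by
  intro u hu
  obtain ⟨x, hx⟩ := hT.2.2.2 1 one_pos u
  rw [Complex.ofReal_one, one_smul] at hx
  have horth : ⟪T x, u⟫ = 0 := (Submodule.mem_orthogonal _ _).mp hu _ (apply_mem_pRange T x)
  have hacc : 0 ≤ (⟪T x, (x : H)⟫).re := by
    rw [← inner_conj_symm, Complex.conj_re]
    exact hT.1 x
  have hTx : T x = 0 := by
    rw [← hx, inner_add_right] at horth
    have hre := congrArg Complex.re horth
    rw [Complex.add_re, Complex.zero_re] at hre
    have hnonpos : (⟪T x, T x⟫).re ≤ 0 := by linarith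
    exact re_inner_self_nonpos (𝕜 := ℂ).mp hnonpos
  rw [hTx, add_zero] at hx
  exact mem_pKer.mpr ⟨hx ▸ x.2, by simpa only [← hx] using hTx⟩

omit [CompleteSpace H] in
lemma IsSquareOf.pKer_eq {T T2 : H →ₗ.[ℂ] H} (hsq : IsSquareOf T T2) (hT : PAccretive T) :
    pKer T2 = pKer T := by
  ext x
  rw [mem_pKer, mem_pKer]
  constructor
  · rintro ⟨h, hx⟩
    obtain ⟨h1, h2, heq⟩ := hsq.1 ⟨x, h⟩
    refine ⟨h1, inner_self_eq_zero (𝕜 := ℂ).mp ?_⟩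
    exact hT.inner_eq_zero (mem_pKer.mpr ⟨h2, heq ▸ hx⟩) ⟨x, h1⟩
  · rintro ⟨h, hx⟩
    have hd : x ∈ T2.domain := (hsq.2 x).mpr ⟨h, hx ▸ T.domain.zero_mem⟩
    obtain ⟨h1, h2, heq⟩ := hsq.1 ⟨x, hd⟩
    refine ⟨hd, heq.trans ?_⟩
    have h0 : (⟨T ⟨x, h1⟩, h2⟩ : T.domain) = 0 := Subtype.ext hx
    rw [h0, LinearPMap.map_zero]

omit [CompleteSpace H] in
lemma IsSquareOf.pRange_le {T T2 : H →ₗ.[ℂ] H} (hsq : IsSquareOf T T2) :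
    pRange T2 ≤ pRange T := by
  rintro _ ⟨x, rfl⟩
  obtain ⟨h1, h2, heq⟩ := hsq.1 x
  exact ⟨_, heq.symm⟩

/-- If `T` is accretive with closed range and `T²` is m-accretive, then `R(T²) = R(T)`. -/
lemma IsSquareOf.pRange_eq {T T2 : H →ₗ.[ℂ] H} (hsq : IsSquareOf T T2) (hT : PAccretive T)
    (h2 : MAccretive T2) (hcl : IsClosed (pRange T : Set H)) : pRange T2 = pRange T := by
  refine le_antisymm hsq.pRange_le ?_
  rintro _ ⟨v, rfl⟩
  have : CompleteSpace (pRange T) := hcl.completeSpace_coe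
  obtain ⟨r, hr, n, hn, hv⟩ := (pRange T).exists_add_mem_mem_orthogonal (v : H)
  have hnT : n ∈ pKer T := by
    rw [← hsq.pKer_eq hT]
    exact h2.orthogonal_pRange_le (Submodule.orthogonal_le hsq.pRange_le hn)
  obtain ⟨hnd, hn0⟩ := mem_pKer.mp hnT
  obtain ⟨w, rfl⟩ := hr
  have hrd : T w ∈ T.domain := by
    have h : T w = (v : H) - n := eq_sub_of_add_eq hv.symm
    rw [h]
    exact T.domain.sub_mem v.2 hnd
  have hvT : T v = T ⟨T w, hrd⟩ := by
    have h : v = ⟨T w, hrd⟩ + ⟨n, hnd⟩ := Subtype.ext hv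
    rw [h, LinearPMap.map_add, hn0, add_zero]
  obtain ⟨_, _, heq⟩ := hsq.1 ⟨w, (hsq.2 w).mpr ⟨w.2, hrd⟩⟩
  exact ⟨_, heq.trans hvT.symm⟩

omit [CompleteSpace H] in
lemma IsSquareOf.sq_gammaP_le {T T2 : H →ₗ.[ℂ] H} (hsq : IsSquareOf T T2) (hT : PAccretive T)
    (h2 : MAccretive T2) : gammaP T ^ 2 ≤ gammaP T2 := by
  have hker := hsq.pKer_eq hT
  by_cases hbot : ∀ x : T2.domain, (x : H) ∈ (pKer T2)ᗮ → (x : H) = 0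
  · have hperp : ∀ y ∈ (pKer T)ᗮ, y = 0 := by
      intro y hy
      obtain ⟨x, hx⟩ := h2.2.2.2 1 one_pos y
      rw [Complex.ofReal_one, one_smul] at hx
      have hxK : (x : H) ∈ (pKer T2)ᗮ := by
        rw [eq_sub_of_add_eq hx, hker]
        exact Submodule.sub_mem _ hy (hT.pRange_le (hsq.pRange_le (apply_mem_pRange T2 x)))
      have hx0 : x = 0 := Subtype.ext (hbot x hxK)
      rw [← hx, hx0, LinearPMap.map_zero, Submodule.coe_zero, add_zero]
    have hempty : gammaP T = 0 := by
      rw [gammaP, ← Real.sInf_empty]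
      refine congrArg sInf (Set.eq_empty_of_forall_notMem ?_)
      rintro r ⟨x, hx, hx1, -⟩
      rw [hperp _ hx, norm_zero] at hx1
      exact zero_ne_one hx1
    rw [hempty, zero_pow two_ne_zero]
    exact gammaP_nonneg T2
  · push Not at hbot
    obtain ⟨x₀, hx₀, hne⟩ := hbot
    refine le_csInf ⟨_, ((‖(x₀ : H)‖⁻¹ : ℝ) : ℂ) • x₀, Submodule.smul_mem _ _ hx₀, ?_, rfl⟩ ?_
    · rw [Submodule.coe_smul, norm_smul, Complex.norm_real, norm_inv, norm_norm,
        inv_mul_cancel₀ (norm_ne_zero_iff.mpr hne)]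
    · rintro r ⟨x, hx, hx1, rfl⟩
      obtain ⟨h1, hd, heq⟩ := hsq.1 x
      rw [hker] at hx
      have hfst := gammaP_mul_norm_le T ⟨x, h1⟩ hx
      have hsnd := gammaP_mul_norm_le T ⟨T ⟨x, h1⟩, hd⟩
        (hT.pRange_le (apply_mem_pRange T ⟨x, h1⟩))
      rw [hx1, mul_one] at hfst
      rw [heq, sq]
      exact (mul_le_mul_of_nonneg_left hfst (gammaP_nonneg T)).trans hsnd

theorem stmt_15 (T T2 : H →ₗ.[ℂ] H) (hT : PAccretive T) (hsq : IsSquareOf T T2)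
    (h2 : MAccretive T2) (hcl : IsClosed ((pRange T : Set H))) :
    IsClosed ((pRange T2 : Set H)) ∧ gammaP T ^ 2 / 2 ≤ gammaP T2 := by
  refine ⟨?_, ?_⟩
  · rwa [hsq.pRange_eq hT h2 hcl]
  · exact (half_le_self (sq_nonneg _)).trans (hsq.sq_gammaP_le hT h2)
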